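/- Let G be a finite group and π a set of primes. Suppose that every element of cs(G) is either a π-number or a π'-number, and that cs(G) contains both a π-number greater than 1 and a π'-number greater than 1. Then |cs(G)| = 3; moreover, up to interchanging π and π', G is an internal direct product G = A × K with A abelian, where K = HL for an abelian Hall π-subgroup H of K and an abelian normal Hall π'-subgroup L of K, and cs(G) = {1, |L|, |H : H ∩ Z(K)|}. -/

import Mathlib

/-- The set of conjugacy class sizes of a group `G`. -/
def csSet (G : Type*) [Group G] : Set ℕ :=
  {n | ∃ g : G, n = (Subgroup.centralizer {g} : Subgroup G).index}

def PiNum (σ : Set ℕ) (n : ℕ) : Prop := ∀ r : ℕ, r.Prime → r ∣ n → r ∈ σ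

set_option linter.unusedSectionVars false
set_option linter.style.haveILetI false

namespace CS

lemma PiNum.dvd {σ : Set ℕ} {m n : ℕ} (h : PiNum σ n) (hm : m ∣ n) : PiNum σ m :=
  fun r hr hd => h r hr (hd.trans hm)

lemma PiNum.coprime {σ : Set ℕ} {m n : ℕ} (h : PiNum σ m) (h' : PiNum σᶜ n) : m.Coprime n :=
  Nat.Coprime.symm (Nat.coprime_of_dvd fun r hr h1 h2 => h' r hr h1 (h r hr h2))

lemma PiNum.eq_one {σ : Set ℕ} {n : ℕ} (h : PiNum σ n) (h' : PiNum σᶜ n) : n = 1 := by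
  simpa using PiNum.coprime h h'

lemma PiNum.one {σ : Set ℕ} : PiNum σ 1 := by
  intro r hr hd
  exact absurd (Nat.dvd_one.1 hd) hr.ne_one

lemma PiNum.prime_pow {σ : Set ℕ} {r k : ℕ} (hr : r.Prime) (h : r ∈ σ) : PiNum σ (r ^ k) := by
  intro q hq hd
  rwa [(Nat.prime_dvd_prime_iff_eq hq hr).1 (hq.dvd_of_dvd_pow hd)]

variable {G : Type*} [Group G] [Finite G]

/-- size of the conjugacy class -/
noncomputable def cl (x : G) : ℕ := (Subgroup.centralizer {x} : Subgroup G).index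

abbrev C (x : G) : Subgroup G := Subgroup.centralizer {x}

lemma mem_C {x g : G} : g ∈ C x ↔ g * x = x * g := Subgroup.mem_centralizer_singleton_iff

lemma mem_C' {x g : G} : g ∈ C x ↔ x ∈ C g := by rw [mem_C, mem_C, eq_comm]

lemma cl_eq (x : G) : cl x = {y | IsConj x y}.ncard := by
  have h := MulAction.index_stabilizer (ConjAct G) x
  have h2 : MulAction.orbit (ConjAct G) x = {y | IsConj x y} := by
    ext y
    rw [ConjAct.mem_orbit_conjAct]
    exact ⟨fun h => h.symm, fun h => h.symm⟩
  rw [h2, ConjAct.stabilizer_eq_centralizer] at h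
  rw [← h, cl]
  rfl

lemma cl_conj {x y : G} (h : IsConj x y) : cl x = cl y := by
  rw [cl_eq, cl_eq]
  congr 1
  ext z
  exact ⟨fun h' => h.symm.trans h', fun h' => h.trans h'⟩

lemma cl_pos (x : G) : 0 < cl x := Nat.pos_of_ne_zero Subgroup.index_ne_zero_of_finite

lemma cl_eq_one {x : G} : cl x = 1 ↔ ∀ g, g * x = x * g := by
  rw [cl, Subgroup.index_eq_one, Subgroup.eq_top_iff']
  simp only [Subgroup.mem_centralizer_singleton_iff]

/-- coprime indices -/
lemma prod_of_coprime {H K : Subgroup G} (h : H.index.Coprime K.index) (g : G) :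
    ∃ k ∈ K, ∃ x ∈ H, g = k * x := by
  have h1 : H.index ∣ H.relIndex K := by
    have : H.index ∣ H.relIndex K * K.index := by
      have := Subgroup.index_dvd_of_le (inf_le_left : H ⊓ K ≤ H)
      rwa [← Subgroup.relIndex_mul_index (inf_le_right : H ⊓ K ≤ K), Subgroup.inf_relIndex_right] at this
    exact h.dvd_of_dvd_mul_right this
  have h2 := MulAction.index_stabilizer K ((1 : G) : G ⧸ H)
  have h3 : MulAction.stabilizer K ((1 : G) : G ⧸ H) = H.subgroupOf K := by
    ext k
    rw [MulAction.mem_stabilizer_iff, Subgroup.mem_subgroupOf]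
    change ((((k : G) * 1 : G)) : G ⧸ H) = _ ↔ _
    rw [eq_comm, QuotientGroup.eq]
    simp
  rw [h3] at h2
  have h4 : MulAction.orbit K ((1 : G) : G ⧸ H) = Set.univ := by
    apply Set.eq_univ_of_univ_subset
    apply (Set.eq_of_subset_of_ncard_le (Set.subset_univ _) _).ge
    rw [← h2, Set.ncard_univ]
    exact Nat.le_of_dvd (Nat.pos_of_ne_zero (Subgroup.index_ne_zero_of_finite)) h1
  have h5 : (g : G ⧸ H) ∈ MulAction.orbit K ((1 : G) : G ⧸ H) := by rw [h4]; trivial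
  obtain ⟨k, hk⟩ := h5
  change ((((k : G) * 1 : G)) : G ⧸ H) = _ at hk
  rw [QuotientGroup.eq] at hk
  refine ⟨k, k.2, _, hk, by group⟩

lemma relIndex_dvd (H K : Subgroup G) [K.Normal] : H.relIndex K ∣ H.index := by
  have h1 : K.relIndex H ∣ K.index := Subgroup.relIndex_dvd_index_of_normal K H
  have e1 := Subgroup.relIndex_mul_index (inf_le_right : H ⊓ K ≤ K)
  have e2 := Subgroup.relIndex_mul_index (inf_le_left : H ⊓ K ≤ H)
  rw [Subgroup.inf_relIndex_right] at e1
  rw [Subgroup.inf_relIndex_left] at e2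
  obtain ⟨c, hc⟩ := h1
  have h0 : K.relIndex H ≠ 0 := by
    intro h; rw [h, zero_mul] at hc; exact Subgroup.index_ne_zero_of_finite hc
  refine ⟨c, ?_⟩
  apply Nat.eq_of_mul_eq_mul_left (Nat.pos_of_ne_zero h0)
  rw [e2, ← e1, hc]; ring

lemma le_of_pi {σ : Set ℕ} {H K : Subgroup G} [K.Normal] (hK : PiNum σ (Nat.card K))
    (hH : PiNum σᶜ H.index) : K ≤ H := by
  rw [← Subgroup.relIndex_eq_one]
  exact PiNum.eq_one (PiNum.dvd hK (Subgroup.relIndex_dvd_card H K)) (PiNum.dvd hH (relIndex_dvd H K))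

/-- conj of an r-element inside -/
lemma conj_mem {r k : ℕ} (hr : r.Prime) {y : G} (hy : orderOf y = r ^ k) {H : Subgroup G}
    (hH : ¬ r ∣ H.index) : ∃ g, g⁻¹ * y * g ∈ H := by
  have := Fact.mk hr
  have hp : IsPGroup r (Subgroup.zpowers y) := by
    apply IsPGroup.of_card (n := k)
    rw [Nat.card_zpowers, hy]
  obtain ⟨q, hq⟩ := hp.nonempty_fixed_point_of_prime_not_dvd_card (G ⧸ H) hH
  induction q using QuotientGroup.induction_on with
  | H g =>
    refine ⟨g, ?_⟩
    have := hq ⟨y, Subgroup.mem_zpowers y⟩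
    change (((y * g : G)) : G ⧸ H) = _ at this
    rw [eq_comm, QuotientGroup.eq] at this
    simpa [mul_assoc] using this

lemma not_dvd_index {r : ℕ} (hr : r.Prime) {H : Subgroup G}
    (h : ∀ y k, orderOf y = r ^ k → y ∈ H) : ¬ r ∣ H.index := by
  have := Fact.mk hr
  obtain ⟨P⟩ : Nonempty (Sylow r G) := inferInstance
  intro hd
  have hle : (P : Subgroup G) ≤ H := by
    intro y hy
    obtain ⟨k, hk⟩ := (IsPGroup.iff_orderOf.1 P.2) ⟨y, hy⟩
    rw [Subgroup.orderOf_mk] at hk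
    exact h y k hk
  exact P.not_dvd_index (hd.trans (Subgroup.index_dvd_of_le hle))

lemma eq_top_of_conj {H : Subgroup G} (h : ∀ x : G, ∃ g, g⁻¹ * x * g ∈ H) : H = ⊤ := by
  classical
  haveI := Fintype.ofFinite G
  haveI : ∀ a : G, Fintype (MulAction.fixedBy (G ⧸ H) a) := fun a => Fintype.ofFinite _
  haveI : Fintype (MulAction.orbitRel.Quotient G (G ⧸ H)) := Fintype.ofFinite _
  have hb := MulAction.sum_card_fixedBy_eq_card_orbits_mul_card_group G (G ⧸ H)
  have h1 : Fintype.card (MulAction.orbitRel.Quotient G (G ⧸ H)) = 1 := by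
    rw [Fintype.card_eq_one_iff_nonempty_unique]
    have : Subsingleton (MulAction.orbitRel.Quotient G (G ⧸ H)) :=
      (MulAction.pretransitive_iff_subsingleton_quotient G (G ⧸ H)).1 inferInstance
    exact ⟨⟨⟨Quotient.mk'' ((1 : G) : G ⧸ H)⟩, fun _ => Subsingleton.elim _ _⟩⟩
  rw [h1, one_mul] at hb
  have h2 : ∀ a : G, 1 ≤ Fintype.card (MulAction.fixedBy (G ⧸ H) a) := by
    intro a
    obtain ⟨g, hg⟩ := h a
    apply Fintype.card_pos_iff.2
    refine ⟨⟨(g : G ⧸ H), ?_⟩⟩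
    change (((a * g : G)) : G ⧸ H) = _
    rw [eq_comm, QuotientGroup.eq]
    simpa [mul_assoc] using hg
  have h3 : ∑ a : G, Fintype.card (MulAction.fixedBy (G ⧸ H) a) = ∑ a : G, 1 := by
    rw [hb]; simp
  have h4 := (Finset.sum_eq_sum_iff_of_le (fun a _ => h2 a)).1 h3.symm 1 (Finset.mem_univ _)
  rw [← Subgroup.index_eq_one, Subgroup.index, h4, ← Nat.card_eq_fintype_card]
  apply Nat.card_congr
  refine ⟨fun q => ⟨q, one_smul _ q⟩, fun q => q.1, fun _ => rfl, fun _ => rfl⟩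

lemma le_of_conj {D H : Subgroup G} (h : ∀ x ∈ D, ∃ g ∈ D, g⁻¹ * x * g ∈ H) : D ≤ H := by
  rw [← Subgroup.subgroupOf_eq_top]
  apply eq_top_of_conj
  rintro ⟨x, hx⟩
  obtain ⟨g, hg, hgx⟩ := h x hx
  exact ⟨⟨g, hg⟩, hgx⟩

lemma card_dvd_of_stable {N : Subgroup G} {S : Set G} (h : ∀ s ∈ S, ∀ n ∈ N, s * n ∈ S) :
    Nat.card N ∣ S.ncard := by
  have h1 := QuotientGroup.card_preimage_mk N ((QuotientGroup.mk : G → G ⧸ N) '' S)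
  have h2 : (QuotientGroup.mk : G → G ⧸ N) ⁻¹' ((QuotientGroup.mk : G → G ⧸ N) '' S) = S := by
    ext x
    constructor
    · rintro ⟨s, hs, hsx⟩
      rw [QuotientGroup.eq] at hsx
      have := h s hs _ hsx
      simpa using this
    · intro hx; exact ⟨x, hx, rfl⟩
  rw [h2] at h1
  exact ⟨_, h1⟩

/-- commutator map is a homomorphism -/
lemma relIndex_dvd_card_of_comm {N D : Subgroup G} (x : G)
    (hNab : ∀ a ∈ N, ∀ b ∈ N, a * b = b * a)
    (hD : ∀ d ∈ D, ∀ n ∈ N, d * n = n * d) (hx : ∀ d ∈ D, d * x * d⁻¹ * x⁻¹ ∈ N) :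
    (C x).relIndex D ∣ Nat.card N := by
  let f : D →* N :=
    { toFun := fun d => ⟨d * x * (d : G)⁻¹ * x⁻¹, hx d d.2⟩
      map_one' := by ext; simp
      map_mul' := by
        intro a b
        ext
        have h1 := hD a a.2 _ (hx b b.2)
        have h2 := hNab _ (hx a a.2) _ (hx b b.2)
        simp only [Subgroup.coe_mul, mul_inv_rev] at *
        rw [h2]
        have : (a : G) * b * x * ((b : G)⁻¹ * (a : G)⁻¹) * x⁻¹
          = (a * (b * x * (b : G)⁻¹ * x⁻¹)) * x * (a : G)⁻¹ * x⁻¹ := by group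
        rw [this, h1]
        group }
  have hk : f.ker = (C x).subgroupOf D := by
    ext d
    rw [MonoidHom.mem_ker, Subgroup.mem_subgroupOf, mem_C]
    constructor
    · intro h
      have h' : (d : G) * x * (d : G)⁻¹ * x⁻¹ = 1 := congrArg Subtype.val h
      rw [mul_inv_eq_one, mul_inv_eq_iff_eq_mul] at h'
      exact h'
    · intro h
      ext
      change (d : G) * x * (d : G)⁻¹ * x⁻¹ = 1
      rw [h]; group
  have : (C x).relIndex D = Nat.card f.range := by
    rw [← Subgroup.index_ker, hk]; rfl
  rw [this]
  exact Subgroup.card_subgroup_dvd_card _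

/-- the coprime order lemma -/
lemma coprime_conj {σ : Set ℕ} {y n : G} (hc : y * n = n * y) (hy : PiNum σᶜ (orderOf y))
    (hn : PiNum σ (orderOf n)) (hconj : IsConj y (y * n)) : n = 1 := by
  have h1 : (y * n) ^ orderOf y = 1 := by
    obtain ⟨c, hc⟩ := isConj_iff.1 hconj
    rw [← hc, conj_pow, pow_orderOf_eq_one]; simp
  rw [Commute.mul_pow hc, pow_orderOf_eq_one, one_mul] at h1
  have h2 := orderOf_dvd_of_pow_eq_one h1
  exact orderOf_eq_one_iff.1 (PiNum.eq_one hn (PiNum.dvd hy h2))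

lemma mem_of_index {σ : Set ℕ} {M : Subgroup G} [M.Normal] {u : G} (hM : PiNum σᶜ M.index)
    (hu : PiNum σ (orderOf u)) : u ∈ M := by
  have h : orderOf (u : G ⧸ M) = 1 := by
    apply PiNum.eq_one (σ := σ)
    · exact PiNum.dvd hu (orderOf_map_dvd (QuotientGroup.mk' M) u)
    · exact PiNum.dvd hM (orderOf_dvd_natCard _)
  rw [orderOf_eq_one_iff] at h
  exact (QuotientGroup.eq_one_iff u).1 h

lemma conj_mul {x b : G} (hco : (cl x).Coprime (cl b)) {x' b' : G} (hx : IsConj x x')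
    (hb : IsConj b b') : IsConj (x * b) (x' * b') := by
  obtain ⟨g, rfl⟩ := isConj_iff.1 hx
  obtain ⟨h, rfl⟩ := isConj_iff.1 hb
  obtain ⟨k, hk, z, hz, e⟩ := prod_of_coprime (H := C b) (K := C x) hco.symm (g⁻¹ * h)
  rw [isConj_iff]
  rw [mem_C] at hk hz
  have e2 : h = g * k * z := by rw [mul_assoc, ← e]; group
  have hk' : k * x * k⁻¹ = x := by rw [hk]; group
  have hz' : z * b * z⁻¹ = b := by rw [hz]; group
  refine ⟨g * k, ?_⟩
  rw [e2]
  calc g * k * (x * b) * (g * k)⁻¹ = g * (k * x * k⁻¹) * g⁻¹ * ((g * k) * b * (g * k)⁻¹) := by group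
    _ = g * x * g⁻¹ * ((g * k) * (z * b * z⁻¹) * (g * k)⁻¹) := by rw [hk', hz']
    _ = _ := by group

lemma cl_le_mul {x b : G} (hco : (cl x).Coprime (cl b)) : cl x ≤ cl (x * b) := by
  rw [cl_eq x, cl_eq (x * b)]
  apply Set.ncard_le_ncard_of_injOn (fun z => z * b)
  · intro z hz
    exact conj_mul hco hz (IsConj.refl b)
  · intro a _ c _ h
    exact mul_right_cancel h

lemma cl_mul_dvd {x b : G} (hco : (cl x).Coprime (cl b)) : cl (x * b) ∣ cl x * cl b := by
  have h1 : C x ⊓ C b ≤ C (x * b) := by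
    rintro g ⟨h1, h2⟩
    have h1' := mem_C.1 h1
    have h2' := mem_C.1 h2
    rw [mem_C, ← mul_assoc, h1', mul_assoc, h2', mul_assoc]
  have h2 : (C x ⊓ C b).index = cl x * cl b := by
    apply le_antisymm Subgroup.index_inf_le
    apply Nat.le_of_dvd (Nat.pos_of_ne_zero Subgroup.index_ne_zero_of_finite)
    exact hco.mul_dvd_of_dvd_of_dvd (Subgroup.index_dvd_of_le inf_le_left)
      (Subgroup.index_dvd_of_le inf_le_right)
  rw [← h2]
  exact Subgroup.index_dvd_of_le h1

lemma stab_of {σ : Set ℕ} {x b : G} (hx : PiNum σ (cl x)) (hb : PiNum σᶜ (cl b))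
    (hxb : PiNum σ (cl (x * b))) {x' b' b'' : G} (hx' : IsConj x x') (hb' : IsConj b b')
    (hb'' : IsConj b b'') : IsConj x (x' * (b' * b''⁻¹)) := by
  have hco := PiNum.coprime hx hb
  have h1 : cl (x * b) = cl x := by
    apply le_antisymm _ (cl_le_mul hco)
    exact Nat.le_of_dvd (cl_pos x)
      ((PiNum.coprime hxb hb).dvd_of_dvd_mul_right (cl_mul_dvd hco))
  have h2 : (fun z => z * b'') '' {y | IsConj x y} = {y | IsConj (x * b) y} := by
    apply Set.eq_of_subset_of_ncard_le
    · rintro _ ⟨z, hz, rfl⟩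
      exact conj_mul hco hz hb''
    · rw [Set.ncard_image_of_injective _ (fun _ _ h => mul_right_cancel h), ← cl_eq, ← cl_eq, h1]
    · exact Set.toFinite _
  have h3 : x' * b' ∈ {y | IsConj (x * b) y} := conj_mul hco hx' hb'
  rw [← h2] at h3
  obtain ⟨z, hz, hzz⟩ := h3
  have : z = x' * (b' * b''⁻¹) := by
    rw [← mul_assoc, ← hzz]; simp
  rw [← this]; exact hz

def Br (S : Set G) : Subgroup G :=
  Subgroup.closure {z | ∃ b ∈ S, ∃ b' b'', IsConj b b' ∧ IsConj b b'' ∧ z = b' * b''⁻¹}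

lemma Br_mem {S : Set G} {b : G} (hb : b ∈ S) (g : G) : g * b * g⁻¹ * b⁻¹ ∈ Br S :=
  Subgroup.subset_closure ⟨b, hb, g * b * g⁻¹, b, isConj_iff.2 ⟨g, rfl⟩, IsConj.refl b, rfl⟩

lemma Br_normal (S : Set G) : (Br S).Normal := by
  constructor
  intro n hn g
  induction hn using Subgroup.closure_induction with
  | mem z hz =>
    obtain ⟨b, hb, b', b'', h1, h2, rfl⟩ := hz
    refine Subgroup.subset_closure ⟨b, hb, g * b' * g⁻¹, g * b'' * g⁻¹, ?_, ?_, by group⟩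
    · exact h1.trans (isConj_iff.2 ⟨g, rfl⟩)
    · exact h2.trans (isConj_iff.2 ⟨g, rfl⟩)
  | one => simp
  | mul a b _ _ ha hb => simpa [mul_assoc] using (Br S).mul_mem ha hb
  | inv a _ ha => simpa [mul_assoc] using (Br S).inv_mem ha

lemma Br_stab {S : Set G} {x : G} (h : ∀ b ∈ S, ∀ x' b' b'', IsConj x x' → IsConj b b' →
    IsConj b b'' → IsConj x (x' * (b' * b''⁻¹))) {n : G} (hn : n ∈ Br S) :
    ∀ x', IsConj x x' ↔ IsConj x (x' * n) := by
  induction hn using Subgroup.closure_induction with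
  | mem z hz =>
    obtain ⟨b, hb, b', b'', h1, h2, rfl⟩ := hz
    intro x'
    refine ⟨fun hx => h b hb _ _ _ hx h1 h2, fun hx => ?_⟩
    have := h b hb _ _ _ hx h2 h1
    have e : x' * (b' * b''⁻¹) * (b'' * b'⁻¹) = x' := by group
    rwa [e] at this
  | one => simp
  | mul a b _ _ ha hb => intro x'; rw [ha, hb, mul_assoc]
  | inv a _ ha => intro x'; rw [ha (x' * a⁻¹)]; simp

lemma Br_card {S : Set G} {x : G} (h : ∀ b ∈ S, ∀ x' b' b'', IsConj x x' → IsConj b b' →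
    IsConj b b'' → IsConj x (x' * (b' * b''⁻¹))) : Nat.card (Br S) ∣ cl x := by
  rw [cl_eq]
  exact card_dvd_of_stable fun s hs n hn => (Br_stab h hn s).1 hs

lemma stage1 {σ : Set ℕ} (hall : ∀ x : G, PiNum σ (cl x) ∨ PiNum σᶜ (cl x)) (a : G)
    (hmax : ∀ x : G, cl x ≤ cl a) (ha : PiNum σ (cl a)) :
    ∃ N : Subgroup G, N.Normal ∧ PiNum σ (Nat.card N) ∧
      (∀ b : G, PiNum σᶜ (cl b) → ∀ g, g * b * g⁻¹ * b⁻¹ ∈ N) ∧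
      (∀ b : G, PiNum σᶜ (cl b) → ∀ n ∈ N, n * b = b * n) ∧
      (∀ m ∈ N, ∀ n ∈ N, m * n = n * m) ∧
      (∀ x : G, PiNum σ (cl x) → cl x ≠ 1 → ∀ n ∈ N, IsConj x (x * n)) := by
  set B : Set G := {b | PiNum σᶜ (cl b)} with hB
  have hNn := Br_normal B
  have hst : ∀ b ∈ B, ∀ x' b' b'', IsConj a x' → IsConj b b' →
    IsConj b b'' → IsConj a (x' * (b' * b''⁻¹)) := by
    intro b hb x' b' b'' h1 h2 h3
    refine stab_of ha hb ?_ h1 h2 h3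
    have : cl (a * b) = cl a := le_antisymm (hmax _) (cl_le_mul (PiNum.coprime ha hb))
    rwa [this]
  have hNc : PiNum σ (Nat.card (Br B)) := PiNum.dvd ha (Br_card hst)
  have hcomm : ∀ b : G, PiNum σᶜ (cl b) → ∀ n ∈ Br B, n * b = b * n := by
    intro b hb n hn
    exact mem_C.1 (le_of_pi (H := C b) hNc hb hn)
  refine ⟨Br B, hNn, hNc, fun b hb g => Br_mem hb g, hcomm, ?_, ?_⟩
  · intro m hm n hn
    have : Br B ≤ C m := by
      refine (Subgroup.closure_le _).2 ?_
      rintro z ⟨b, hb, b', b'', h1, h2, rfl⟩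
      have hb' : PiNum σᶜ (cl b') := by rw [← cl_conj h1]; exact hb
      have hb'' : PiNum σᶜ (cl b'') := by rw [← cl_conj h2]; exact hb
      exact (C m).mul_mem (mem_C.2 (hcomm _ hb' m hm).symm)
        ((C m).inv_mem (mem_C.2 (hcomm _ hb'' m hm).symm))
    exact (mem_C.1 (this hn)).symm
  · intro x hx hx1 n hn
    refine (Br_stab (S := B) ?_ hn x).1 (IsConj.refl x)
    intro b hb x' b' b'' h1 h2 h3
    refine stab_of hx hb ?_ h1 h2 h3
    rcases hall (x * b) with h | h
    · exact h
    exfalso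
    have hbx : PiNum σᶜ (cl (b * x)) := by
      rwa [cl_conj (x := b * x) (y := x * b) (isConj_iff.2 ⟨x, by group⟩)]
    have hxx : PiNum σᶜᶜ (cl x) := by rwa [compl_compl]
    have hM := Br_normal ({x} : Set G)
    have hMc : PiNum σᶜ (Nat.card (Br ({x} : Set G))) := by
      refine PiNum.dvd hb (Br_card ?_)
      rintro _ rfl x' b' b'' h1 h2 h3
      exact stab_of hb hxx hbx h1 h2 h3
    have hdis : Disjoint (Br B) (Br ({x} : Set G)) :=
      Subgroup.disjoint_of_coprime_natCard (PiNum.coprime hNc hMc)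
    have hcen : ∀ g : G, ∀ m ∈ Br ({x} : Set G), g * m = m * g := by
      intro g m hm
      rcases hall g with hg | hg
      · have hgg : PiNum σᶜᶜ (cl g) := by rwa [compl_compl]
        exact (mem_C.1 (le_of_pi (H := C g) hMc hgg hm)).symm
      · have h1 : m * g * m⁻¹ * g⁻¹ ∈ Br B := Br_mem hg m
        have h2 : m * g * m⁻¹ * g⁻¹ ∈ Br ({x} : Set G) := by
          have := (Br ({x} : Set G)).mul_mem hm (hM.conj_mem _ ((Br ({x} : Set G)).inv_mem hm) g)
          simpa [mul_assoc] using this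
        have h3 := Subgroup.disjoint_def.1 hdis h1 h2
        rw [mul_inv_eq_one, mul_inv_eq_iff_eq_mul] at h3
        exact h3.symm
    have hd := relIndex_dvd_card_of_comm (N := Br ({x} : Set G)) (D := ⊤) x
      (fun p _ q hq => hcen p q hq) (fun d _ n hn => hcen d n hn) (fun d _ => Br_mem (Set.mem_singleton x) d)
    rw [Subgroup.relIndex_top_right] at hd
    exact hx1 (PiNum.eq_one hx (PiNum.dvd hMc hd))

lemma pi_central {σ : Set ℕ} {x : G} (h : cl x = 1) : PiNum σ (cl x) := by
  rw [h]; exact PiNum.one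

lemma split_of {N : Subgroup G} [hNn : N.Normal] (hNab : ∀ m ∈ N, ∀ n ∈ N, m * n = n * m) {y b : G}
    (hf : ∀ n ∈ N, y * n = n * y → n = 1) (hb : y * b * y⁻¹ * b⁻¹ ∈ N)
    (hbc : ∀ n ∈ N, n * b = b * n) : ∃ n ∈ N, b * n ∈ C y := by
  let f : N → N := fun n => ⟨y * n * y⁻¹ * (n : G)⁻¹,
    N.mul_mem (hNn.conj_mem _ n.2 y) (N.inv_mem n.2)⟩
  have hinj : Function.Injective f := by
    rintro ⟨n, hn⟩ ⟨m, hm⟩ h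
    have h' : y * n * y⁻¹ * n⁻¹ = y * m * y⁻¹ * m⁻¹ := congrArg Subtype.val h
    have h2 : m⁻¹ * n = 1 := by
      apply hf _ (N.mul_mem (N.inv_mem hm) hn)
      have c1 := hNab _ (hNn.conj_mem _ (N.inv_mem hm) y) _
        (N.mul_mem (hNn.conj_mem _ hm y) (N.inv_mem hm))
      calc y * (m⁻¹ * n) = (y * m⁻¹ * y⁻¹) * (y * n * y⁻¹ * n⁻¹) * n * y := by group
        _ = (y * m * y⁻¹ * m⁻¹) * (y * m⁻¹ * y⁻¹) * n * y := by rw [h', c1]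
        _ = (y * m * y⁻¹) * (m⁻¹ * (y * m⁻¹ * y⁻¹)) * n * y := by group
        _ = (y * m * y⁻¹) * ((y * m⁻¹ * y⁻¹) * m⁻¹) * n * y := by
          rw [hNab _ (N.inv_mem hm) _ (hNn.conj_mem _ (N.inv_mem hm) y)]
        _ = _ := by group
    ext
    exact (inv_mul_eq_one.1 h2).symm
  obtain ⟨⟨n, hn⟩, hfn⟩ := (Finite.injective_iff_surjective.1 hinj) ⟨_, N.inv_mem hb⟩
  have hfn' : y * n * y⁻¹ * n⁻¹ = (y * b * y⁻¹ * b⁻¹)⁻¹ := congrArg Subtype.val hfn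
  refine ⟨n, hn, mem_C.2 ?_⟩
  have c1 := hbc _ hb
  symm
  calc y * (b * n) = (y * b * y⁻¹ * b⁻¹) * b * (y * n * y⁻¹ * n⁻¹) * n * y := by group
    _ = b * n * y := by rw [c1, hfn']; group

lemma stage2 {σ : Set ℕ} (hall : ∀ x : G, PiNum σ (cl x) ∨ PiNum σᶜ (cl x))
    (b₀ : G) (hb₀ : PiNum σᶜ (cl b₀)) (hb₀1 : cl b₀ ≠ 1)
    (N : Subgroup G) [hNn : N.Normal] (hNc : PiNum σ (Nat.card N))
    (hBN : ∀ b : G, PiNum σᶜ (cl b) → ∀ g, g * b * g⁻¹ * b⁻¹ ∈ N)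
    (hBc : ∀ b : G, PiNum σᶜ (cl b) → ∀ n ∈ N, n * b = b * n)
    (hNab : ∀ m ∈ N, ∀ n ∈ N, m * n = n * m)
    (hAN : ∀ x : G, PiNum σ (cl x) → cl x ≠ 1 → ∀ n ∈ N, IsConj x (x * n)) :
    (∃ n ∈ N, n ≠ 1) ∧
    (∀ y : G, PiNum σᶜ (orderOf y) → cl y ≠ 1 → PiNum σ (cl y)) ∧
    (∀ y : G, PiNum σᶜ (orderOf y) → cl y ≠ 1 → ∀ n ∈ N, y * n = n * y → n = 1) ∧
    ∃ D : Subgroup G, D.Normal ∧ PiNum σᶜ D.index ∧ (∀ b : G, b ∈ D ↔ PiNum σᶜ (cl b)) ∧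
      (∀ x ∈ D, ∀ y ∈ D, x * y = y * x) := by
  have hNo : ∀ n ∈ N, PiNum σ (orderOf n) := fun n hn =>
    PiNum.dvd hNc (Subgroup.orderOf_dvd_natCard N hn)
  have hN1 : ∃ n ∈ N, n ≠ 1 := by
    by_contra! h
    apply hb₀1
    rw [cl_eq_one]
    intro g
    have := h _ (hBN b₀ hb₀ g)
    rwa [mul_inv_eq_one, mul_inv_eq_iff_eq_mul] at this
  -- step 5
  have hyA : ∀ y : G, PiNum σᶜ (orderOf y) → cl y ≠ 1 → PiNum σ (cl y) := by
    intro y hy hy1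
    rcases hall y with h | h
    · exact h
    exfalso
    apply hy1
    rw [cl_eq_one]
    intro g
    have h1 := hBN y h g
    have h2 := coprime_conj (σ := σ) (hBc y h _ h1).symm hy (hNo _ h1) (by
      rw [← hBc y h _ h1]
      exact isConj_iff.2 ⟨g, by group⟩)
    rwa [mul_inv_eq_one, mul_inv_eq_iff_eq_mul] at h2
  -- step 8
  have hfpf : ∀ y : G, PiNum σᶜ (orderOf y) → cl y ≠ 1 → ∀ n ∈ N, y * n = n * y → n = 1 := by
    intro y hy hy1 n hn hc
    exact coprime_conj (σ := σ) hc hy (hNo n hn) (hAN y (hyA y hy hy1) hy1 n hn)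
  -- step 7
  have hNB : ∀ n ∈ N, PiNum σᶜ (cl n) := by
    intro n hn
    rcases hall n with h | h
    · by_cases h1 : cl n = 1
      · exact pi_central h1
      · exfalso
        have := hAN n h h1 n⁻¹ (N.inv_mem hn)
        rw [mul_inv_cancel] at this
        have h2 := isConj_one_left.1 this
        apply h1
        rw [cl_eq_one, h2]; simp
    · exact h
  obtain ⟨D, hDdef⟩ : ∃ D : Subgroup G, D = Subgroup.centralizer (N : Set G) := ⟨_, rfl⟩
  have hDn : D.Normal := by rw [hDdef]; infer_instance
  have hDm : ∀ d, d ∈ D ↔ ∀ n ∈ N, n * d = d * n := by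
    intro d; rw [hDdef, Subgroup.mem_centralizer_iff]; rfl
  have hBD : ∀ b : G, PiNum σᶜ (cl b) → b ∈ D := fun b hb => (hDm b).2 (hBc b hb)
  have hND : N ≤ D := fun n hn => hBD n (hNB n hn)
  -- step 4
  have hDB : ∀ b : G, PiNum σᶜ (cl b) → D ≤ C b := by
    intro b hb
    rw [← Subgroup.relIndex_eq_one]
    refine PiNum.eq_one (σ := σ) (PiNum.dvd hNc ?_) (PiNum.dvd hb (relIndex_dvd _ _))
    exact relIndex_dvd_card_of_comm b hNab (fun d hd n hn => ((hDm d).1 hd n hn).symm)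
      (fun d _ => hBN b hb d)
  -- the element y₀
  obtain ⟨r₀, hr₀, hr₀σ, y₀, k₀, hy₀, hy₀1⟩ : ∃ r₀ : ℕ, r₀.Prime ∧ r₀ ∈ σᶜ ∧ ∃ (y₀ : G) (k₀ : ℕ),
      orderOf y₀ = r₀ ^ k₀ ∧ cl y₀ ≠ 1 := by
    obtain ⟨r, hr, hrd⟩ := Nat.exists_prime_and_dvd hb₀1
    refine ⟨r, hr, hb₀ r hr hrd, ?_⟩
    by_contra! h
    refine not_dvd_index (H := C b₀) hr ?_ hrd
    intro y k hy
    exact mem_C.2 (cl_eq_one.1 (h y k hy) b₀).symm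
  -- step 9
  have hconj : ∀ (r k : ℕ) (y : G), r.Prime → r ∈ σᶜ → orderOf y = r ^ k →
      ∀ x, PiNum σ (cl x) → ∃ g, g⁻¹ * y * g ∈ C x := by
    intro r k y hr hrσ hy x hx
    exact conj_mem hr hy (fun hd => hrσ (hx r hr hd))
  have hCD : ∀ (r k : ℕ) (y : G), r.Prime → r ∈ σᶜ → orderOf y = r ^ k → C y ⊔ D = ⊤ := by
    intro r k y hr hrσ hy
    apply eq_top_of_conj
    intro x
    rcases hall x with hx | hx
    · obtain ⟨g, hg⟩ := hconj r k y hr hrσ hy x hx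
      refine ⟨g⁻¹, Subgroup.mem_sup_left ?_⟩
      rw [mem_C] at hg ⊢
      calc g⁻¹⁻¹ * x * g⁻¹ * y = g * (x * (g⁻¹ * y * g)) * g⁻¹ := by group
        _ = g * ((g⁻¹ * y * g) * x) * g⁻¹ := by rw [hg]
        _ = _ := by group
    · exact ⟨1, Subgroup.mem_sup_right (by simpa using hBD x hx)⟩
  have hyD : ∀ (r k : ℕ) (y : G), r.Prime → r ∈ σᶜ → orderOf y = r ^ k →
      ∀ g, g * y * g⁻¹ * y⁻¹ ∈ D := by
    intro r k y hr hrσ hy g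
    have hg : g ∈ D ⊔ C y := by rw [sup_comm, hCD r k y hr hrσ hy]; trivial
    obtain ⟨d, hd, c, hc, rfl⟩ := Subgroup.mem_sup_of_normal_left.1 hg
    rw [mem_C] at hc
    have e : d * c * y * (d * c)⁻¹ * y⁻¹ = d * (y * d⁻¹ * y⁻¹) := by
      rw [mul_assoc d c y, hc]; group
    rw [e]
    exact D.mul_mem hd (hDn.conj_mem _ (D.inv_mem hd) y)
  -- step 10
  have hpD : ∀ (p k : ℕ) (u : G), p.Prime → p ∈ σ → orderOf u = p ^ k → u ∈ D := by
    intro p k u hp hpσ hu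
    rw [hDm]
    intro n hn
    have hM : PiNum σᶜ (C n).index := hNB n hn
    have hDM : D ≤ C n := hDB n (hNB n hn)
    have hnor : Subgroup.normalizer (C n : Set G) = ⊤ := by
      rw [← Subgroup.index_eq_one]
      refine PiNum.eq_one (σ := σ) ?_ (PiNum.dvd hM (Subgroup.index_dvd_of_le Subgroup.le_normalizer))
      intro r hr hrd
      by_contra hrσ
      refine not_dvd_index hr ?_ hrd
      intro y k hy
      have key : ∀ y : G, orderOf y = r ^ k → ∀ m ∈ C n, y * m * y⁻¹ ∈ C n := by
        intro y hy m hm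
        have h1 := hDM (hyD r k y hr hrσ hy m)
        have e : y * m * y⁻¹ = (m * y * m⁻¹ * y⁻¹)⁻¹ * m := by group
        rw [e]
        exact (C n).mul_mem ((C n).inv_mem h1) hm
      rw [Subgroup.mem_normalizer_iff]
      intro m
      refine ⟨key y hy m, fun h => ?_⟩
      have := key y⁻¹ (by rw [orderOf_inv, hy]) _ h
      simpa [mul_assoc] using this
    have : (C n).Normal := Subgroup.normalizer_eq_top_iff.1 hnor
    have hu' : u ∈ C n := mem_of_index hM (by rw [hu]; exact PiNum.prime_pow hp hpσ)
    exact (mem_C.1 hu').symm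
  have hDi : PiNum σᶜ D.index := by
    intro p hp hpd hpσ
    exact not_dvd_index hp (fun u k hu => hpD p k u hp hpσ hu) hpd
  have hy₀' : PiNum σᶜ (orderOf y₀) := by rw [hy₀]; exact PiNum.prime_pow hr₀ hr₀σ
  -- step 11
  have hsplit : ∀ b, PiNum σᶜ (cl b) → ∃ c ∈ C y₀ ⊓ D, ∃ n ∈ N, c * n = b := by
    intro b hb
    obtain ⟨n, hn, h⟩ := split_of hNab (hfpf y₀ hy₀' hy₀1) (hBN b hb y₀) (hBc b hb)
    exact ⟨b * n, ⟨h, D.mul_mem (hBD b hb) (hND hn)⟩, n⁻¹, N.inv_mem hn, by group⟩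
  have hDdec : ∀ x ∈ D, ∃ c ∈ C y₀ ⊓ D, ∃ n ∈ N, c * n = x := by
    have : D ≤ (C y₀ ⊓ D) ⊔ N := by
      apply le_of_conj
      intro x hx
      rcases hall x with h | h
      · obtain ⟨g, hg⟩ := hconj r₀ k₀ y₀ hr₀ hr₀σ hy₀ x h
        obtain ⟨d, hd, c, hc, rfl⟩ := prod_of_coprime (H := C x) (K := D) (PiNum.coprime h hDi) g
        refine ⟨d⁻¹, D.inv_mem hd, ?_⟩
        have hg2 : d⁻¹ * y₀ * d ∈ C x := by
          have := (C x).mul_mem ((C x).mul_mem hc hg) ((C x).inv_mem hc)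
          have e : c * ((d * c)⁻¹ * y₀ * (d * c)) * c⁻¹ = d⁻¹ * y₀ * d := by group
          rwa [e] at this
        refine Subgroup.mem_sup_left ⟨?_, by simpa using hDn.conj_mem x hx d⟩
        rw [mem_C] at hg2
        refine mem_C.2 ?_
        calc d⁻¹⁻¹ * x * d⁻¹ * y₀ = d * (x * (d⁻¹ * y₀ * d)) * d⁻¹ := by group
          _ = d * ((d⁻¹ * y₀ * d) * x) * d⁻¹ := by rw [hg2]
          _ = _ := by group
      · obtain ⟨c, hc, n, hn, rfl⟩ := hsplit x h
        refine ⟨1, D.one_mem, ?_⟩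
        simpa using Subgroup.mul_mem_sup hc hn
    intro x hx
    obtain ⟨c, hc, n, hn, e⟩ := Subgroup.mem_sup_of_normal_right.1 (this hx)
    exact ⟨c, hc, n, hn, e⟩
  have hDsub : ∀ u ∈ D, PiNum σᶜ (cl u) := by
    intro u hu
    rcases hall u with h | h
    · by_cases h1 : cl u = 1
      · exact pi_central h1
      exfalso
      obtain ⟨n, hn, hn1⟩ := hN1
      obtain ⟨g, hg⟩ := isConj_iff.1 (hAN u h h1 n hn)
      obtain ⟨d, hd, c, hc, rfl⟩ := prod_of_coprime (H := C u) (K := D) (PiNum.coprime h hDi) g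
      rw [mem_C] at hc
      have hg' : d * u * d⁻¹ = u * n := by
        rw [← hg, mul_assoc d c u, hc]; group
      obtain ⟨e, he, m, hm, rfl⟩ := hDdec d hd
      obtain ⟨e', he', m', hm', rfl⟩ := hDdec u hu
      apply hn1
      apply hfpf y₀ hy₀' hy₀1 n hn
      have c1 : ∀ d ∈ D, ∀ n ∈ N, n * d = d * n := fun d hd n hn => (hDm d).1 hd n hn
      have c2 := c1 _ hu m hm
      have c3 := c1 _ (D.inv_mem he.2) m' hm'
      have c4 := hNab m' hm' n hn
      have e1 : e * m * (e' * m') * (e * m)⁻¹ = e * e' * e⁻¹ * m' := by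
        calc e * m * (e' * m') * (e * m)⁻¹ = e * (m * (e' * m')) * m⁻¹ * e⁻¹ := by group
          _ = e * ((e' * m') * m) * m⁻¹ * e⁻¹ := by rw [c2]
          _ = e * e' * (m' * e⁻¹) := by group
          _ = _ := by rw [c3]; group
      rw [e1, mul_assoc e', c4, ← mul_assoc] at hg'
      have e2 : n = e'⁻¹ * (e * e' * e⁻¹) := by
        rw [mul_right_cancel hg']; group
      have : n ∈ C y₀ := by
        rw [e2]
        exact (C y₀).mul_mem ((C y₀).inv_mem he'.1)
          ((C y₀).mul_mem ((C y₀).mul_mem he.1 he'.1) ((C y₀).inv_mem he.1))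
      exact (mem_C.1 this).symm
    · exact h
  exact ⟨hN1, hyA, hfpf, D, hDn, hDi, fun b => ⟨hDsub b, hBD b⟩,
    fun x hx y hy => mem_C.1 (hDB y (hDsub y hy) hx)⟩

lemma hall_sub {σ : Set ℕ} (D : Subgroup G) [hDn : D.Normal] (hDi : PiNum σᶜ D.index)
    (hDab : ∀ x ∈ D, ∀ y ∈ D, x * y = y * x) :
    ∃ P : Subgroup G, P.Normal ∧ PiNum σ (Nat.card P) ∧ PiNum σᶜ P.index ∧
      (∀ x, x ∈ P ↔ x ∈ D ∧ PiNum σ (orderOf x)) := by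
  let P : Subgroup G :=
    { carrier := {x | x ∈ D ∧ PiNum σ (orderOf x)}
      one_mem' := ⟨D.one_mem, by rw [orderOf_one]; exact PiNum.one⟩
      mul_mem' := by
        rintro x y ⟨hx, hx'⟩ ⟨hy, hy'⟩
        refine ⟨D.mul_mem hx hy, ?_⟩
        have h1 := Commute.orderOf_mul_dvd_mul_orderOf (hDab x hx y hy)
        intro r hr hd
        rcases (hr.dvd_mul).1 (hd.trans h1) with h | h
        · exact hx' r hr h
        · exact hy' r hr h
      inv_mem' := by
        rintro x ⟨hx, hx'⟩
        exact ⟨D.inv_mem hx, by rwa [orderOf_inv]⟩ }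
  have hP : ∀ x, x ∈ P ↔ x ∈ D ∧ PiNum σ (orderOf x) := fun x => Iff.rfl
  refine ⟨P, ⟨?_⟩, ?_, ?_, hP⟩
  · intro n hn g
    rw [hP] at hn ⊢
    refine ⟨hDn.conj_mem _ hn.1 g, ?_⟩
    have : orderOf (g * n * g⁻¹) = orderOf n := by
      exact orderOf_injective (MulAut.conj g).toMonoidHom (MulAut.conj g).injective n
    rw [this]; exact hn.2
  · intro r hr hd
    have := Fact.mk hr
    obtain ⟨x, hx⟩ := exists_prime_orderOf_dvd_card' r hd
    rw [← Subgroup.orderOf_coe] at hx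
    exact x.2.2 r hr (by rw [hx])
  · intro p hp hpd hpσ
    refine not_dvd_index hp ?_ hpd
    intro u k hu
    have h : PiNum σ (orderOf u) := by rw [hu]; exact PiNum.prime_pow hp hpσ
    exact ⟨mem_of_index hDi h, h⟩

def Concl (G : Type*) [Group G] (σ : Set ℕ) : Prop :=
    (csSet G).ncard = 3 ∧
    ∃ A K : Subgroup G,
      (∀ x ∈ A, ∀ y ∈ A, x * y = y * x) ∧
      (∃ e : (↥A × ↥K) ≃* G, ∀ (x : A) (y : K), e (x, y) = (x : G) * y) ∧
      ∃ H L : Subgroup K,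
        (∀ x ∈ H, ∀ y ∈ H, x * y = y * x) ∧
        (∀ x ∈ L, ∀ y ∈ L, x * y = y * x) ∧
        L.Normal ∧ H ⊔ L = ⊤ ∧
        (PiNum σᶜ (Nat.card H) ∧ PiNum σ H.index ∧ PiNum σ (Nat.card L) ∧ PiNum σᶜ L.index) ∧
        csSet G = {1, Nat.card L, ((Subgroup.center K).subgroupOf H).index}

lemma stage3 {σ : Set ℕ} (hall : ∀ x : G, PiNum σ (cl x) ∨ PiNum σᶜ (cl x))
    (a₀ : G) (ha₀ : PiNum σ (cl a₀)) (ha₀1 : cl a₀ ≠ 1)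
    (b₀ : G) (hb₀ : PiNum σᶜ (cl b₀)) (hb₀1 : cl b₀ ≠ 1)
    (N : Subgroup G) [hNn : N.Normal] (hNc : PiNum σ (Nat.card N))
    (hBN : ∀ b : G, PiNum σᶜ (cl b) → ∀ g, g * b * g⁻¹ * b⁻¹ ∈ N)
    (hBc : ∀ b : G, PiNum σᶜ (cl b) → ∀ n ∈ N, n * b = b * n)
    (hNab : ∀ m ∈ N, ∀ n ∈ N, m * n = n * m)
    (hAN : ∀ x : G, PiNum σ (cl x) → cl x ≠ 1 → ∀ n ∈ N, IsConj x (x * n))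
    (hyA : ∀ y : G, PiNum σᶜ (orderOf y) → cl y ≠ 1 → PiNum σ (cl y))
    (hfpf : ∀ y : G, PiNum σᶜ (orderOf y) → cl y ≠ 1 → ∀ n ∈ N, y * n = n * y → n = 1)
    (D : Subgroup G) [hDn : D.Normal] (hDi : PiNum σᶜ D.index)
    (hDm : ∀ b : G, b ∈ D ↔ PiNum σᶜ (cl b))
    (hDab : ∀ x ∈ D, ∀ y ∈ D, x * y = y * x) : Concl G σ := by
  have hNo : ∀ n ∈ N, PiNum σ (orderOf n) := fun n hn =>
    PiNum.dvd hNc (Subgroup.orderOf_dvd_natCard N hn)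
  obtain ⟨P, hPn, hPc, hPi, hPm⟩ := hall_sub D hDi hDab
  have hND : N ≤ D := fun n hn => mem_of_index hDi (hNo n hn)
  have hNP : N ≤ P := fun n hn => (hPm n).2 ⟨hND hn, hNo n hn⟩
  have hPD : P ≤ D := fun x hx => ((hPm x).1 hx).1
  obtain ⟨Q, hPQ⟩ := Subgroup.exists_right_complement'_of_coprime (N := P) (PiNum.coprime hPc hPi)
  have hQc : PiNum σᶜ (Nat.card Q) := by rw [← hPQ.symm.index_eq_card]; exact hPi
  have hQo : ∀ q ∈ Q, PiNum σᶜ (orderOf q) := fun q hq =>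
    PiNum.dvd hQc (Subgroup.orderOf_dvd_natCard Q hq)
  have hdis := hPQ.disjoint
  have hdec : ∀ g : G, ∃ p ∈ P, ∃ q ∈ Q, p * q = g := by
    intro g
    have : g ∈ P ⊔ Q := by rw [hPQ.sup_eq_top]; trivial
    obtain ⟨p, hp, q, hq, e⟩ := Subgroup.mem_sup_of_normal_left.1 this
    exact ⟨p, hp, q, hq, e⟩
  have hQab : ∀ x ∈ Q, ∀ q ∈ Q, x * q = q * x := by
    intro x hx q hq
    by_cases h1 : cl x = 1
    · exact (cl_eq_one.1 h1 q).symm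
    · have hxA := hyA x (hQo x hx) h1
      obtain ⟨p, hp, c, hc, rfl⟩ := prod_of_coprime (H := C x) (K := P) (PiNum.coprime hxA hPi) q
      rw [mem_C] at hc
      have e : p * c * x * (p * c)⁻¹ * x⁻¹ = p * (x * p⁻¹ * x⁻¹) := by
        rw [mul_assoc p c x, hc]; group
      have h2 : p * c * x * (p * c)⁻¹ * x⁻¹ ∈ P := by
        rw [e]; exact P.mul_mem hp (hPn.conj_mem _ (P.inv_mem hp) x)
      have h3 : p * c * x * (p * c)⁻¹ * x⁻¹ ∈ Q :=
        Q.mul_mem (Q.mul_mem (Q.mul_mem hq hx) (Q.inv_mem hq)) (Q.inv_mem hx)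
      have h4 := Subgroup.disjoint_def.1 hdis h2 h3
      rw [mul_inv_eq_one, mul_inv_eq_iff_eq_mul] at h4
      exact h4.symm
  have hcen_of : ∀ x : G, (∀ p ∈ P, p * x = x * p) → (∀ q ∈ Q, q * x = x * q) → cl x = 1 := by
    intro x h1 h2
    rw [cl_eq_one]
    intro g
    obtain ⟨p, hp, q, hq, rfl⟩ := hdec g
    rw [mul_assoc, h2 q hq, ← mul_assoc, h1 p hp, mul_assoc]
  obtain ⟨y, hyQ, hy1⟩ : ∃ y ∈ Q, cl y ≠ 1 := by
    by_contra! h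
    apply hb₀1
    apply hcen_of
    · intro p hp
      exact hDab _ (hPD hp) _ ((hDm b₀).2 hb₀)
    · intro q hq
      exact (cl_eq_one.1 (h q hq) b₀).symm
  have hyo := hQo y hyQ
  -- decomposition of D
  have hDdec : ∀ b ∈ D, ∃ c ∈ D, ∃ n ∈ N, cl c = 1 ∧ c * n = b := by
    intro b hb
    obtain ⟨n, hn, h⟩ := split_of hNab (hfpf y hyo hy1) (hBN b ((hDm b).1 hb) y)
      (hBc b ((hDm b).1 hb))
    have hbn : b * n ∈ D := D.mul_mem hb (hND hn)
    refine ⟨b * n, hbn, n⁻¹, N.inv_mem hn, ?_, by group⟩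
    apply hcen_of
    · intro p hp
      exact hDab _ (hPD hp) _ hbn
    · intro q hq
      have h1 := hBN _ ((hDm _).1 hbn) q
      have h2 : q ∈ C y := mem_C.2 (hQab q hq y hyQ)
      have h3 : q * (b * n) * q⁻¹ * (b * n)⁻¹ ∈ C y :=
        (C y).mul_mem ((C y).mul_mem ((C y).mul_mem h2 h) ((C y).inv_mem h2)) ((C y).inv_mem h)
      have h4 := hfpf y hyo hy1 _ h1 (mem_C.1 h3).symm
      rwa [mul_inv_eq_one, mul_inv_eq_iff_eq_mul] at h4
  -- commutators
  have hcomm : ∀ g x : G, g * x * g⁻¹ * x⁻¹ ∈ N := by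
    have hq : ∀ q ∈ Q, ∀ x : G, x * q * x⁻¹ * q⁻¹ ∈ N := by
      intro q hq x
      obtain ⟨p, hp, q', hq', rfl⟩ := hdec x
      have e : p * q' * q * (p * q')⁻¹ * q⁻¹ = (q * p * q⁻¹ * p⁻¹)⁻¹ := by
        rw [mul_assoc p q' q, hQab q' hq' q hq]; group
      rw [e]
      exact N.inv_mem (hBN p ((hDm p).1 (hPD hp)) q)
    intro g x
    obtain ⟨p, hp, q, hq', rfl⟩ := hdec x
    have e : g * (p * q) * g⁻¹ * (p * q)⁻¹
      = (g * p * g⁻¹ * p⁻¹) * (p * (g * q * g⁻¹ * q⁻¹) * p⁻¹) := by group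
    rw [e]
    exact N.mul_mem (hBN p ((hDm p).1 (hPD hp)) g) (hNn.conj_mem _ (hq q hq' g) p)
  -- class sizes
  have hclA : ∀ x : G, PiNum σ (cl x) → cl x ≠ 1 → cl x = Nat.card N := by
    intro x hx hx1
    rw [cl_eq]
    have : {z | IsConj x z} = (fun n => x * n) '' (N : Set G) := by
      ext z
      constructor
      · intro hz
        obtain ⟨g, rfl⟩ := isConj_iff.1 hz
        refine ⟨x⁻¹ * (g * x * g⁻¹), ?_, by group⟩
        have := hNn.conj_mem _ (hcomm g x) x⁻¹
        have e : x⁻¹ * (g * x * g⁻¹ * x⁻¹) * x⁻¹⁻¹ = x⁻¹ * (g * x * g⁻¹) := by group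
        rwa [e] at this
      · rintro ⟨n, hn, rfl⟩
        exact hAN x hx hx1 n hn
    rw [this, Set.ncard_image_of_injective _ (fun _ _ h => mul_left_cancel h)]
    rfl
  have hclB : ∀ b : G, PiNum σᶜ (cl b) → cl b ≠ 1 → cl b = (Subgroup.center G).relIndex Q := by
    intro b hb hb1
    have hbD := (hDm b).2 hb
    have hDC : D ≤ C b := fun d hd => mem_C.2 (hDab d hd b hbD)
    have hCn : (C b).Normal := by
      constructor
      intro n hn g
      have := (C b).mul_mem (hDC (hND (hcomm g n))) hn
      simpa [mul_assoc] using this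
    have h1 : (C b).relIndex (Q ⊔ C b) = (C b).relIndex Q := Subgroup.relIndex_sup_right _ _
    have h2 : Q ⊔ C b = ⊤ := by
      rw [eq_top_iff, ← hPQ.sup_eq_top]
      exact sup_le ((hPD.trans hDC).trans le_sup_right) le_sup_left
    rw [h2, Subgroup.relIndex_top_right] at h1
    change (C b).index = _
    rw [h1, ← Subgroup.inf_relIndex_right, ← Subgroup.inf_relIndex_right (Subgroup.center G)]
    congr 1
    ext q
    simp only [Subgroup.mem_inf, Subgroup.mem_center_iff]
    refine and_congr_left fun hq => ⟨fun h => ?_, fun h => mem_C.2 (h b).symm⟩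
    by_contra h'
    have hq1 : cl q ≠ 1 := by
      rw [Ne, cl_eq_one]; exact h'
    obtain ⟨c, hc, n, hn, hc1, rfl⟩ := hDdec b hbD
    rw [cl_eq_one] at hc1
    have hqn : q * n = n * q := by
      have e := mem_C.1 h
      rw [← mul_assoc, hc1 q, mul_assoc, mul_assoc] at e
      exact mul_left_cancel e
    have := hfpf q (hQo q hq) hq1 n hn hqn
    apply hb1
    rw [cl_eq_one, this]
    simpa using hc1
  have hcs : csSet G = {1, Nat.card N, (Subgroup.center G).relIndex Q} := by
    ext m
    simp only [Set.mem_insert_iff, Set.mem_singleton_iff]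
    constructor
    · rintro ⟨g, rfl⟩
      change cl g = 1 ∨ cl g = _ ∨ cl g = _
      by_cases h : cl g = 1
      · exact Or.inl h
      · rcases hall g with hg | hg
        · exact Or.inr (Or.inl (hclA g hg h))
        · exact Or.inr (Or.inr (hclB g hg h))
    · rintro (rfl | rfl | rfl)
      · refine ⟨1, ?_⟩
        change 1 = cl (1 : G)
        symm
        rw [cl_eq_one]; simp
      · exact ⟨a₀, (hclA a₀ ha₀ ha₀1).symm⟩
      · exact ⟨b₀, (hclB b₀ hb₀ hb₀1).symm⟩
  have hKdec : ∀ k ∈ N ⊔ Q, ∃ n ∈ N, ∃ q ∈ Q, n * q = k := fun k hk => by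
    obtain ⟨n, hn, q, hq, e⟩ := Subgroup.mem_sup_of_normal_left.1 hk
    exact ⟨n, hn, q, hq, e⟩
  have hGdec : ∀ g : G, ∃ c ∈ P ⊓ Subgroup.center G, ∃ k ∈ N ⊔ Q, c * k = g := by
    intro g
    obtain ⟨p, hp, q, hq, rfl⟩ := hdec g
    obtain ⟨c, _, n, hn, hc1, rfl⟩ := hDdec p (hPD hp)
    have hcP : c ∈ P := by
      have := P.mul_mem hp (P.inv_mem (hNP hn))
      rwa [mul_inv_cancel_right] at this
    exact ⟨c, ⟨hcP, Subgroup.mem_center_iff.2 (cl_eq_one.1 hc1)⟩, n * q,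
      Subgroup.mul_mem_sup hn hq, by group⟩
  have hAK : Disjoint (P ⊓ Subgroup.center G) (N ⊔ Q) := by
    rw [Subgroup.disjoint_def]
    intro x hx hxK
    obtain ⟨n, hn, q, hq, rfl⟩ := hKdec x hxK
    have hqP : q ∈ P := by
      have := P.mul_mem (P.inv_mem (hNP hn)) hx.1
      rwa [inv_mul_cancel_left] at this
    have hq1 : q = 1 := Subgroup.disjoint_def.1 hdis hqP hq
    subst hq1
    rw [mul_one] at hx ⊢
    exact hfpf y hyo hy1 n hn (Subgroup.mem_center_iff.1 hx.2 y)
  have hKc : Subgroup.IsComplement' (N.subgroupOf (N ⊔ Q)) (Q.subgroupOf (N ⊔ Q)) := by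
    apply Subgroup.isComplement'_of_disjoint_and_mul_eq_univ
    · rw [Subgroup.disjoint_def]
      rintro ⟨x, _⟩ hx hx'
      exact Subtype.ext (Subgroup.disjoint_def.1 hdis (hNP hx) hx')
    · apply Set.eq_univ_of_forall
      rintro ⟨k, hk⟩
      obtain ⟨n, hn, q, hq, rfl⟩ := hKdec k hk
      exact ⟨⟨n, Subgroup.mem_sup_left hn⟩, hn, ⟨q, Subgroup.mem_sup_right hq⟩, hq, rfl⟩
  have hcN : Nat.card (N.subgroupOf (N ⊔ Q)) = Nat.card N :=
    Nat.card_congr (Subgroup.subgroupOfEquivOfLe le_sup_left).toEquiv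
  have hcQ : Nat.card (Q.subgroupOf (N ⊔ Q)) = Nat.card Q :=
    Nat.card_congr (Subgroup.subgroupOfEquivOfLe le_sup_right).toEquiv
  have hcenK : Subgroup.center (N ⊔ Q : Subgroup G) = (Subgroup.center G).subgroupOf (N ⊔ Q) := by
    ext ⟨z, hz⟩
    rw [Subgroup.mem_subgroupOf, Subgroup.mem_center_iff, Subgroup.mem_center_iff]
    constructor
    · intro h g
      obtain ⟨c, hc, k, hk, rfl⟩ := hGdec g
      have h1 : k * z = z * k := congrArg Subtype.val (h ⟨k, hk⟩)
      have h2 := Subgroup.mem_center_iff.1 hc.2 z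
      change c * k * z = z * (c * k)
      rw [mul_assoc, h1, ← mul_assoc, ← h2, mul_assoc]
    · rintro h ⟨k, hk⟩
      exact Subtype.ext (h k)
  refine ⟨?_, P ⊓ Subgroup.center G, N ⊔ Q, ?_, ?_, Q.subgroupOf (N ⊔ Q), N.subgroupOf (N ⊔ Q),
    ?_, ?_, inferInstance, ?_, ?_, ?_⟩
  · rw [hcs, Set.ncard_eq_three]
    refine ⟨_, _, _, ?_, ?_, ?_, rfl⟩
    · rw [← hclA a₀ ha₀ ha₀1]; exact ha₀1.symm
    · rw [← hclB b₀ hb₀ hb₀1]; exact hb₀1.symm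
    · rw [← hclA a₀ ha₀ ha₀1, ← hclB b₀ hb₀ hb₀1]
      intro h
      exact ha₀1 (PiNum.eq_one ha₀ (h ▸ hb₀))
  · intro x hx z _
    exact ((Subgroup.mem_center_iff.1 hx.2) z).symm
  · have hcm : ∀ (m : ↥(P ⊓ Subgroup.center G)) (n : ↥(N ⊔ Q)),
        Commute ((P ⊓ Subgroup.center G).subtype m) ((N ⊔ Q).subtype n) := by
      intro m n
      exact ((Subgroup.mem_center_iff.1 m.2.2) n).symm
    refine ⟨MulEquiv.ofBijective (MonoidHom.noncommCoprod _ _ hcm) ⟨?_, ?_⟩, fun x y => rfl⟩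
    · rw [injective_iff_map_eq_one]
      rintro ⟨⟨c, hc⟩, ⟨k, hk⟩⟩ h
      have h' : c * k = 1 := h
      have hck : c = k⁻¹ := eq_inv_of_mul_eq_one_left h'
      have hc1 : c = 1 := Subgroup.disjoint_def.1 hAK hc (hck ▸ (N ⊔ Q).inv_mem hk)
      have hk1 : k = 1 := by rw [hc1, one_mul] at h'; exact h'
      subst hc1 hk1
      rfl
    · intro g
      obtain ⟨c, hc, k, hk, rfl⟩ := hGdec g
      exact ⟨(⟨c, hc⟩, ⟨k, hk⟩), rfl⟩
  · rintro ⟨x, _⟩ hx ⟨z, _⟩ hz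
    exact Subtype.ext (hQab x hx z hz)
  · rintro ⟨x, _⟩ hx ⟨z, _⟩ hz
    exact Subtype.ext (hNab x hx z hz)
  · exact hKc.symm.sup_eq_top
  · rw [hKc.index_eq_card, hKc.symm.index_eq_card, hcN, hcQ]
    exact ⟨hQc, hNc, hNc, hQc⟩
  · rw [hcs, hcN, hcenK]
    congr 3
    exact (Subgroup.relIndex_subgroupOf (H := Subgroup.center G)
      (le_sup_right : Q ≤ N ⊔ Q)).symm

lemma core {σ : Set ℕ} (hall : ∀ x : G, PiNum σ (cl x) ∨ PiNum σᶜ (cl x))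
    (a : G) (hmax : ∀ x : G, cl x ≤ cl a) (ha : PiNum σ (cl a)) (ha1 : cl a ≠ 1)
    (b : G) (hb : PiNum σᶜ (cl b)) (hb1 : cl b ≠ 1) : Concl G σ := by
  obtain ⟨N, hNn, hNc, hBN, hBc, hNab, hAN⟩ := stage1 hall a hmax ha
  obtain ⟨_, hyA, hfpf, D, hDn, hDi, hDm, hDab⟩ := stage2 hall b hb hb1 N hNc hBN hBc hNab hAN
  exact stage3 hall a ha ha1 b hb hb1 N hNc hBN hBc hNab hAN hyA hfpf D hDi hDm hDab

end CS

/-- If every conjugacy class size of a finite group `G` is either a `π`-number or a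
`π'`-number, and both kinds occur nontrivially, then `|cs(G)| = 3` and, up to interchanging
`π` and `π'`, `G = A × K` with `A` abelian, `K = HL` with `H` an abelian Hall `π`-subgroup
of `K` and `L` an abelian normal Hall `π'`-subgroup of `K`, and
`cs(G) = {1, |L|, |H : H ∩ Z(K)|}`. -/
theorem stmt_14 (G : Type*) [Group G] [Finite G] (π : Set ℕ)
    (hπ : ∀ p ∈ π, p.Prime)
    (hall : ∀ n ∈ csSet G,
      (∀ r : ℕ, r.Prime → r ∣ n → r ∈ π) ∨ (∀ r : ℕ, r.Prime → r ∣ n → r ∉ π))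
    (hex : ∃ n ∈ csSet G, 1 < n ∧ ∀ r : ℕ, r.Prime → r ∣ n → r ∈ π)
    (hex' : ∃ n ∈ csSet G, 1 < n ∧ ∀ r : ℕ, r.Prime → r ∣ n → r ∉ π) :
    (csSet G).ncard = 3 ∧
    ∃ A K : Subgroup G,
      (∀ x ∈ A, ∀ y ∈ A, x * y = y * x) ∧
      (∃ e : (↥A × ↥K) ≃* G, ∀ (x : A) (y : K), e (x, y) = (x : G) * y) ∧
      ∃ H L : Subgroup K,
        (∀ x ∈ H, ∀ y ∈ H, x * y = y * x) ∧
        (∀ x ∈ L, ∀ y ∈ L, x * y = y * x) ∧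
        L.Normal ∧ H ⊔ L = ⊤ ∧
        (((∀ r : ℕ, r.Prime → r ∣ Nat.card H → r ∈ π) ∧
          (∀ r : ℕ, r.Prime → r ∣ H.index → r ∉ π) ∧
          (∀ r : ℕ, r.Prime → r ∣ Nat.card L → r ∉ π) ∧
          (∀ r : ℕ, r.Prime → r ∣ L.index → r ∈ π)) ∨
         ((∀ r : ℕ, r.Prime → r ∣ Nat.card H → r ∉ π) ∧
          (∀ r : ℕ, r.Prime → r ∣ H.index → r ∈ π) ∧
          (∀ r : ℕ, r.Prime → r ∣ Nat.card L → r ∈ π) ∧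
          (∀ r : ℕ, r.Prime → r ∣ L.index → r ∉ π))) ∧
        csSet G = {1, Nat.card L, ((Subgroup.center K).subgroupOf H).index} := by
  obtain ⟨na, ⟨a, rfl⟩, ha1, ha⟩ := hex
  obtain ⟨nb, ⟨b, rfl⟩, hb1, hb⟩ := hex'
  have hall' : ∀ x : G, PiNum π (CS.cl x) ∨ PiNum πᶜ (CS.cl x) := fun x => hall _ ⟨x, rfl⟩
  obtain ⟨m, hm⟩ := Finite.exists_max (fun x : G => CS.cl x)
  have hm1 : CS.cl m ≠ 1 := by
    have h := hm a
    have h2 : 1 < CS.cl a := ha1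
    have h3 : CS.cl a ≤ CS.cl m := h
    omega
  rcases hall' m with h | h
  · obtain ⟨h1, A, K, h2, h3, H, L, h4, h5, h6, h7, ⟨h8, h9, h10, h11⟩, h12⟩ :=
      CS.core hall' m hm h hm1 b hb (ne_of_gt hb1)
    exact ⟨h1, A, K, h2, h3, H, L, h4, h5, h6, h7, Or.inr ⟨h8, h9, h10, h11⟩, h12⟩
  · have hall'' : ∀ x : G, PiNum πᶜ (CS.cl x) ∨ PiNum πᶜᶜ (CS.cl x) := by
      intro x
      rw [compl_compl]
      exact (hall' x).symm
    have ha' : PiNum πᶜᶜ (CS.cl a) := by rw [compl_compl]; exact ha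
    obtain ⟨h1, A, K, h2, h3, H, L, h4, h5, h6, h7, ⟨h8, h9, h10, h11⟩, h12⟩ :=
      CS.core hall'' m hm h hm1 a ha' (ne_of_gt ha1)
    rw [compl_compl] at h8 h11
    exact ⟨h1, A, K, h2, h3, H, L, h4, h5, h6, h7, Or.inl ⟨h8, h9, h10, h11⟩, h12⟩
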